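/- Let N ≥ 1, let f ∈ S(ℝ^N), let φ : ℝ^N → ℝ be bounded and Lipschitz continuous, and let i ∈ {1,…,N}. Then the principal-value limits defining R_i f(x) exist for a.e. x, the double integral below converges absolutely, and ∫_{ℝ^N} φ(x) f(x) R_i f(x) dx = (c_N/2) ∫_{ℝ^N}∫_{ℝ^N} ((x_i − y_i)(φ(x) − φ(y))/|x−y|^{N+1}) f(x) f(y) dx dy. -/

import Mathlib

open MeasureTheory Filter Topology SchwartzMap
open scoped ENNReal FourierTransform

/-- The truncated Riesz-transform integral `∫_{|x-y| ≥ ε} (x_i - y_i) f(y) / |x-y|^{N+1} dy`. -/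
noncomputable def rieszTrunc (N : ℕ) (i : Fin N) (f : EuclideanSpace ℝ (Fin N) → ℝ)
    (x : EuclideanSpace ℝ (Fin N)) (ε : ℝ) : ℝ :=
  ∫ y in {y : EuclideanSpace ℝ (Fin N) | ε ≤ ‖x - y‖}, ((x i - y i) * f y) / ‖x - y‖ ^ (N + 1)

/-- The (unnormalized) Riesz kernel `z_i / |z|^{N+1}`. -/
noncomputable def rieszKernel (N : ℕ) (i : Fin N) (z : EuclideanSpace ℝ (Fin N)) : ℝ :=
  z i / ‖z‖ ^ (N + 1)

/-- The Riesz kernel truncated to `{z | ε ≤ |z|}`. -/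
noncomputable def rieszKernelTrunc (N : ℕ) (i : Fin N) (ε : ℝ) :
    EuclideanSpace ℝ (Fin N) → ℝ :=
  {z | ε ≤ ‖z‖}.indicator (rieszKernel N i)

/-- The function `|z|^{1-N}` on the unit ball, extended by zero. -/
noncomputable def localRieszMajorant (N : ℕ) (z : EuclideanSpace ℝ (Fin N)) : ℝ :=
  (Set.Iio 1).indicator (fun r : ℝ => r * (r ^ N)⁻¹) ‖z‖

section RieszKernel

variable {N : ℕ} (i : Fin N)

theorem abs_rieszKernel_le (z : EuclideanSpace ℝ (Fin N)) :
    |rieszKernel N i z| ≤ (‖z‖ ^ N)⁻¹ := by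
  rcases eq_or_ne z 0 with rfl | hz
  · simp [rieszKernel]
  have hz' : 0 < ‖z‖ := norm_pos_iff.2 hz
  have hi : |z i| ≤ ‖z‖ := PiLp.norm_apply_le z i
  rw [rieszKernel, abs_div, abs_of_pos (pow_pos hz' (N + 1)), div_le_iff₀ (by positivity), pow_succ,
    inv_mul_cancel_left₀ (by positivity)]
  exact hi

theorem rieszKernel_neg (z : EuclideanSpace ℝ (Fin N)) :
    rieszKernel N i (-z) = -rieszKernel N i z := by
  simp [rieszKernel, neg_div]

theorem measurable_rieszKernel : Measurable (rieszKernel N i) := by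
  unfold rieszKernel
  fun_prop

theorem abs_rieszKernelTrunc_le_abs (ε : ℝ) (z : EuclideanSpace ℝ (Fin N)) :
    |rieszKernelTrunc N i ε z| ≤ |rieszKernel N i z| :=
  norm_indicator_le_norm_self (rieszKernel N i) z

theorem abs_rieszKernelTrunc_le {ε : ℝ} (hε : 0 < ε) (z : EuclideanSpace ℝ (Fin N)) :
    |rieszKernelTrunc N i ε z| ≤ (ε ^ N)⁻¹ := by
  by_cases hz : ε ≤ ‖z‖
  · refine ((abs_rieszKernelTrunc_le_abs i ε z).trans (abs_rieszKernel_le i z)).trans ?_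
    gcongr
  · rw [rieszKernelTrunc, Set.indicator_of_notMem (by simpa using hz), abs_zero]
    positivity

theorem rieszKernelTrunc_neg (ε : ℝ) (z : EuclideanSpace ℝ (Fin N)) :
    rieszKernelTrunc N i ε (-z) = -rieszKernelTrunc N i ε z := by
  by_cases hz : ε ≤ ‖z‖ <;> simp [rieszKernelTrunc, hz, rieszKernel_neg]

theorem measurable_rieszKernelTrunc (ε : ℝ) : Measurable (rieszKernelTrunc N i ε) :=
  (measurable_rieszKernel i).indicator (measurableSet_le measurable_const measurable_norm)

theorem tendsto_rieszKernelTrunc (z : EuclideanSpace ℝ (Fin N)) :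
    Tendsto (fun ε : ℝ => rieszKernelTrunc N i ε z) (𝓝[>] 0) (𝓝 (rieszKernel N i z)) := by
  rcases eq_or_ne z 0 with rfl | hz
  · have h : ∀ ε, rieszKernelTrunc N i ε 0 = rieszKernel N i 0 := fun ε => by
      simp [rieszKernelTrunc, rieszKernel, Set.indicator_apply]
    simp [h]
  · refine tendsto_const_nhds.congr' ?_
    filter_upwards [Ioo_mem_nhdsGT (norm_pos_iff.2 hz)] with ε hε
    simp [rieszKernelTrunc, hε.2.le]

theorem localRieszMajorant_nonneg (z : EuclideanSpace ℝ (Fin N)) :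
    0 ≤ localRieszMajorant N z := by
  rw [localRieszMajorant, Set.indicator_apply]
  split_ifs <;> positivity

theorem integrable_localRieszMajorant (hN : 1 ≤ N) :
    Integrable (localRieszMajorant N) := by
  have : Nonempty (Fin N) := ⟨⟨0, hN⟩⟩
  unfold localRieszMajorant
  rw [integrable_fun_norm_addHaar volume (f := (Set.Iio 1).indicator fun r : ℝ => r * (r ^ N)⁻¹),
    finrank_euclideanSpace_fin,
    integrableOn_congr_fun (g := (Set.Iio 1).indicator fun _ : ℝ => (1 : ℝ)) ?_ measurableSet_Ioi]
  · rw [IntegrableOn, integrable_indicator_iff measurableSet_Iio]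
    refine integrableOn_const ?_
    rw [Measure.restrict_apply measurableSet_Iio, Set.Iio_inter_Ioi]
    simp
  · intro r (hr : 0 < r)
    by_cases h1 : r < 1
    · have : r ^ (N - 1) * r = r ^ N := by rw [← pow_succ, Nat.sub_add_cancel hN]
      simp only [Set.mem_Iio, h1, Set.indicator_of_mem, smul_eq_mul]
      rw [← mul_assoc, this, mul_inv_cancel₀ (by positivity)]
    · simp [h1]

theorem abs_rieszKernel_mul_le {z : EuclideanSpace ℝ (Fin N)} {t L : ℝ} (ht : |t| ≤ L * ‖z‖) :
    |rieszKernel N i z * t| ≤ L * localRieszMajorant N z + |t| := by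
  rw [abs_mul]
  have hk := abs_rieszKernel_le i z
  by_cases h1 : ‖z‖ < 1
  · have hm : localRieszMajorant N z = ‖z‖ * (‖z‖ ^ N)⁻¹ := by simp [localRieszMajorant, h1]
    rw [hm]
    calc |rieszKernel N i z| * |t| ≤ (‖z‖ ^ N)⁻¹ * (L * ‖z‖) := by gcongr
      _ = L * (‖z‖ * (‖z‖ ^ N)⁻¹) := by ring
      _ ≤ _ := le_add_of_nonneg_right (abs_nonneg t)
  · have hm : localRieszMajorant N z = 0 := by simp [localRieszMajorant, h1]
    have : (‖z‖ ^ N)⁻¹ ≤ 1 := inv_le_one_of_one_le₀ (one_le_pow₀ (not_lt.1 h1))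
    rw [hm, mul_zero, zero_add]
    exact mul_le_of_le_one_left (abs_nonneg t) (hk.trans this)

theorem abs_rieszKernelTrunc_mul_le (ε : ℝ) {z : EuclideanSpace ℝ (Fin N)} {t L : ℝ}
    (ht : |t| ≤ L * ‖z‖) :
    |rieszKernelTrunc N i ε z * t| ≤ L * localRieszMajorant N z + |t| := by
  refine le_trans ?_ (abs_rieszKernel_mul_le i ht)
  rw [abs_mul, abs_mul]
  exact mul_le_mul_of_nonneg_right (abs_rieszKernelTrunc_le_abs i ε z) (abs_nonneg t)

variable {f : EuclideanSpace ℝ (Fin N) → ℝ}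

theorem rieszTrunc_eq_integral_mul (x : EuclideanSpace ℝ (Fin N)) (ε : ℝ) :
    rieszTrunc N i f x ε = ∫ y, rieszKernelTrunc N i ε (x - y) * f y := by
  rw [rieszTrunc, ← integral_indicator (measurableSet_le (by fun_prop) (by fun_prop))]
  congr 1 with y
  by_cases h : ε ≤ ‖x - y‖ <;> simp [rieszKernelTrunc, rieszKernel, h, div_mul_eq_mul_div]

theorem rieszTrunc_eq_integral_sub (hf : Integrable f) (x : EuclideanSpace ℝ (Fin N))
    {ε : ℝ} (hε : 0 < ε) :
    rieszTrunc N i f x ε =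
      (1 / 2) * ∫ z, rieszKernelTrunc N i ε z * (f (x - z) - f (x + z)) := by
  have hbdd : ∀ g : EuclideanSpace ℝ (Fin N) → ℝ, Integrable g →
      Integrable (fun z => rieszKernelTrunc N i ε z * g z) := fun g hg =>
    hg.bdd_mul (measurable_rieszKernelTrunc i ε).aestronglyMeasurable
      (ae_of_all _ (abs_rieszKernelTrunc_le i hε))
  have hsub : rieszTrunc N i f x ε = ∫ z, rieszKernelTrunc N i ε z * f (x - z) := by
    rw [rieszTrunc_eq_integral_mul,
      ← integral_sub_left_eq_self (fun z => rieszKernelTrunc N i ε z * f (x - z)) volume x]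
    simp
  have hadd : rieszTrunc N i f x ε = -∫ z, rieszKernelTrunc N i ε z * f (x + z) := by
    rw [hsub, ← integral_neg_eq_self (fun z => rieszKernelTrunc N i ε z * f (x - z)) volume,
      ← integral_neg]
    simp [rieszKernelTrunc_neg]
  simp only [mul_sub]
  rw [integral_sub (hbdd _ (hf.comp_sub_left x)) (hbdd _ (hf.comp_add_left x))]
  linarith

/-- A majorant, integrable in `z`, of the symmetrized integrand defining the Riesz transform. -/
noncomputable def symmRieszMajorant (N : ℕ) (f : EuclideanSpace ℝ (Fin N) → ℝ) (L : ℝ)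
    (x z : EuclideanSpace ℝ (Fin N)) : ℝ :=
  2 * L * localRieszMajorant N z + (|f (x - z)| + |f (x + z)|)

theorem integrable_symmRieszMajorant (hN : 1 ≤ N) (hf : Integrable f) (L : ℝ)
    (x : EuclideanSpace ℝ (Fin N)) : Integrable (symmRieszMajorant N f L x) :=
  ((integrable_localRieszMajorant hN).const_mul _).add
    ((hf.comp_sub_left x).abs.add (hf.comp_add_left x).abs)

theorem integral_symmRieszMajorant (hN : 1 ≤ N) (hf : Integrable f) (L : ℝ)
    (x : EuclideanSpace ℝ (Fin N)) :
    ∫ z, symmRieszMajorant N f L x z =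
      2 * L * (∫ z, localRieszMajorant N z) + ((∫ z, |f z|) + ∫ z, |f z|) := by
  have h1 := (hf.comp_sub_left x).abs
  have h2 := (hf.comp_add_left x).abs
  unfold symmRieszMajorant
  rw [integral_add ((integrable_localRieszMajorant hN).const_mul _)
      (g := fun z => |f (x - z)| + |f (x + z)|) (h1.add h2),
    integral_add h1 h2, integral_const_mul,
    integral_sub_left_eq_self (fun z => |f z|) volume x,
    integral_add_left_eq_self (fun z => |f z|) x]

theorem abs_rieszKernelTrunc_mul_sub_le {L : NNReal} (hL : LipschitzWith L f) (ε : ℝ)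
    (x z : EuclideanSpace ℝ (Fin N)) :
    |rieszKernelTrunc N i ε z * (f (x - z) - f (x + z))| ≤ symmRieszMajorant N f L x z := by
  have ht : |f (x - z) - f (x + z)| ≤ 2 * L * ‖z‖ := by
    have h := hL.norm_sub_le (x - z) (x + z)
    have h2 : x - z - (x + z) = -((2 : ℝ) • z) := by rw [two_smul]; abel
    rw [h2, norm_neg, norm_smul, Real.norm_ofNat, Real.norm_eq_abs] at h
    linarith
  refine (abs_rieszKernelTrunc_mul_le i ε ht).trans ?_
  unfold symmRieszMajorant
  gcongr
  exact abs_sub _ _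

theorem abs_rieszTrunc_le (hN : 1 ≤ N) (hf : Integrable f) {L : NNReal} (hL : LipschitzWith L f)
    (x : EuclideanSpace ℝ (Fin N)) {ε : ℝ} (hε : 0 < ε) :
    |rieszTrunc N i f x ε| ≤ L * (∫ z, localRieszMajorant N z) + ∫ z, |f z| := by
  have h := norm_integral_le_of_norm_le
    (f := fun z => rieszKernelTrunc N i ε z * (f (x - z) - f (x + z))) (integrable_symmRieszMajorant hN hf L x)
    (ae_of_all _ (abs_rieszKernelTrunc_mul_sub_le i hL ε x))
  rw [integral_symmRieszMajorant hN hf, Real.norm_eq_abs] at h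
  rw [rieszTrunc_eq_integral_sub i hf x hε, abs_mul, abs_of_pos (by norm_num : (0 : ℝ) < 1 / 2)]
  linarith

theorem tendsto_rieszTrunc (hN : 1 ≤ N) (hf : Integrable f) {L : NNReal} (hL : LipschitzWith L f)
    (x : EuclideanSpace ℝ (Fin N)) :
    Tendsto (fun ε => rieszTrunc N i f x ε) (𝓝[>] 0)
      (𝓝 ((1 / 2) * ∫ z, rieszKernel N i z * (f (x - z) - f (x + z)))) := by
  have hcont := hL.continuous
  have h := tendsto_integral_filter_of_dominated_convergence (l := 𝓝[>] (0 : ℝ))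
    (F := fun ε z => rieszKernelTrunc N i ε z * (f (x - z) - f (x + z)))
    (f := fun z => rieszKernel N i z * (f (x - z) - f (x + z))) (symmRieszMajorant N f L x)
    (.of_forall fun ε => ((measurable_rieszKernelTrunc i ε).mul
      (by fun_prop : Continuous fun z => f (x - z) - f (x + z)).measurable).aestronglyMeasurable)
    (.of_forall fun ε => ae_of_all _ (abs_rieszKernelTrunc_mul_sub_le i hL ε x))
    (integrable_symmRieszMajorant hN hf L x)
    (ae_of_all _ fun z => (tendsto_rieszKernelTrunc i z).mul_const _)
  refine (h.const_mul (1 / 2)).congr' ?_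
  filter_upwards [self_mem_nhdsWithin] with ε hε
  exact (rieszTrunc_eq_integral_sub i hf x hε).symm

variable {φ : EuclideanSpace ℝ (Fin N) → ℝ}

/-- A majorant of the kernel of the commutator of `φ` with a Riesz transform. -/
noncomputable def commutatorMajorant (N : ℕ) (f : EuclideanSpace ℝ (Fin N) → ℝ) (K C : ℝ)
    (p : EuclideanSpace ℝ (Fin N) × EuclideanSpace ℝ (Fin N)) : ℝ :=
  (K * localRieszMajorant N (p.1 - p.2) + 2 * C) * (|f p.1| * |f p.2|)

theorem abs_rieszKernelTrunc_mul_sub_mul_le {K : NNReal} (hK : LipschitzWith K φ) {C : ℝ}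
    (hC : ∀ x, |φ x| ≤ C) (ε : ℝ) (p : EuclideanSpace ℝ (Fin N) × EuclideanSpace ℝ (Fin N)) :
    |rieszKernelTrunc N i ε (p.1 - p.2) * (φ p.1 - φ p.2) * (f p.1 * f p.2)| ≤
      commutatorMajorant N f K C p := by
  rw [abs_mul, abs_mul (f p.1), commutatorMajorant]
  gcongr
  refine (abs_rieszKernelTrunc_mul_le i ε (hK.norm_sub_le p.1 p.2)).trans ?_
  gcongr
  have := abs_sub (φ p.1) (φ p.2)
  linarith [hC p.1, hC p.2]

theorem integrable_commutatorMajorant (hN : 1 ≤ N) (hf : Integrable f) (hcont : Continuous f)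
    {M : ℝ} (hM : ∀ x, |f x| ≤ M) (K C : ℝ) :
    Integrable (commutatorMajorant N f K C) (volume.prod volume) := by
  have hconv := hf.abs.convolution_integrand (ContinuousLinearMap.mul ℝ ℝ)
    (integrable_localRieszMajorant hN)
  have hloc := (hconv.bdd_mul (f := fun p : EuclideanSpace ℝ (Fin N) × EuclideanSpace ℝ (Fin N) =>
    |f p.1|) (by fun_prop) (ae_of_all _ fun p => by simpa using hM p.1)).const_mul K
  refine (hloc.add ((hf.abs.mul_prod hf.abs).const_mul (2 * C))).congr (ae_of_all _ fun p => ?_)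
  simp only [commutatorMajorant, Pi.add_apply, ContinuousLinearMap.mul_apply']
  ring

theorem tendsto_integral_rieszKernelTrunc_commutator (hN : 1 ≤ N) (hf : Integrable f)
    (hcont : Continuous f) {M : ℝ} (hM : ∀ x, |f x| ≤ M) {K : NNReal} (hK : LipschitzWith K φ)
    {C : ℝ} (hC : ∀ x, |φ x| ≤ C) :
    Tendsto (fun ε => ∫ p : EuclideanSpace ℝ (Fin N) × EuclideanSpace ℝ (Fin N),
        rieszKernelTrunc N i ε (p.1 - p.2) * (φ p.1 - φ p.2) * (f p.1 * f p.2)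
          ∂(volume.prod volume)) (𝓝[>] 0)
      (𝓝 (∫ p : EuclideanSpace ℝ (Fin N) × EuclideanSpace ℝ (Fin N),
        rieszKernel N i (p.1 - p.2) * (φ p.1 - φ p.2) * (f p.1 * f p.2)
          ∂(volume.prod volume))) := by
  have hφ := hK.continuous
  refine tendsto_integral_filter_of_dominated_convergence (commutatorMajorant N f K C)
    (.of_forall fun ε => ?_)
    (.of_forall fun ε => ae_of_all _ (abs_rieszKernelTrunc_mul_sub_mul_le i hK hC ε))
    (integrable_commutatorMajorant hN hf hcont hM K C)
    (ae_of_all _ fun p => ((tendsto_rieszKernelTrunc i _).mul_const _).mul_const _)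
  have := measurable_rieszKernelTrunc i ε
  exact Measurable.aestronglyMeasurable (by fun_prop)

theorem integrable_rieszKernel_commutator (hN : 1 ≤ N) (hf : Integrable f)
    (hcont : Continuous f) {M : ℝ} (hM : ∀ x, |f x| ≤ M) {K : NNReal} (hK : LipschitzWith K φ)
    {C : ℝ} (hC : ∀ x, |φ x| ≤ C) :
    Integrable (fun p : EuclideanSpace ℝ (Fin N) × EuclideanSpace ℝ (Fin N) =>
      rieszKernel N i (p.1 - p.2) * (φ p.1 - φ p.2) * (f p.1 * f p.2)) (volume.prod volume) := by
  have hφ := hK.continuous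
  have := measurable_rieszKernel i
  refine (integrable_commutatorMajorant hN hf hcont hM K C).mono'
    (Measurable.aestronglyMeasurable (by fun_prop)) (ae_of_all _ fun p => ?_)
  exact le_of_tendsto (((tendsto_rieszKernelTrunc i _).mul_const _).mul_const _).norm
    (.of_forall fun ε => abs_rieszKernelTrunc_mul_sub_mul_le i hK hC ε p)

theorem integrable_rieszKernelTrunc_mul (hf : Integrable f) (hφ : Continuous φ)
    {C : ℝ} (hC : ∀ x, |φ x| ≤ C) {ε : ℝ} (hε : 0 < ε) :
    Integrable (fun p : EuclideanSpace ℝ (Fin N) × EuclideanSpace ℝ (Fin N) =>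
      rieszKernelTrunc N i ε (p.1 - p.2) * (φ p.1 * f p.1 * f p.2)) (volume.prod volume) := by
  have hφf : Integrable (fun x => φ x * f x) :=
    hf.bdd_mul hφ.aestronglyMeasurable (ae_of_all _ hC)
  have := measurable_rieszKernelTrunc i ε
  exact (hφf.mul_prod hf).bdd_mul (Measurable.aestronglyMeasurable (by fun_prop))
    (ae_of_all _ fun p => abs_rieszKernelTrunc_le i hε (p.1 - p.2))

theorem integral_rieszKernelTrunc_mul (x : EuclideanSpace ℝ (Fin N)) (ε : ℝ) :
    ∫ y, rieszKernelTrunc N i ε (x - y) * (φ x * f x * f y) =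
      φ x * f x * rieszTrunc N i f x ε := by
  rw [rieszTrunc_eq_integral_mul, ← integral_const_mul]
  congr 1 with y
  ring

theorem integral_mul_rieszTrunc (hf : Integrable f) (hφ : Continuous φ)
    {C : ℝ} (hC : ∀ x, |φ x| ≤ C) {ε : ℝ} (hε : 0 < ε) :
    ∫ x, φ x * f x * rieszTrunc N i f x ε =
      (1 / 2) * ∫ p : EuclideanSpace ℝ (Fin N) × EuclideanSpace ℝ (Fin N),
        rieszKernelTrunc N i ε (p.1 - p.2) * (φ p.1 - φ p.2) * (f p.1 * f p.2)
          ∂(volume.prod volume) := by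
  have hint := integrable_rieszKernelTrunc_mul i hf hφ hC hε
  have hiter := integral_prod _ hint
  simp only [integral_rieszKernelTrunc_mul] at hiter
  have hsum := integral_add hint hint.swap
  have hswap := integral_prod_swap (μ := volume) (ν := volume)
    fun p : EuclideanSpace ℝ (Fin N) × EuclideanSpace ℝ (Fin N) =>
      rieszKernelTrunc N i ε (p.1 - p.2) * (φ p.1 * f p.1 * f p.2)
  simp only [Function.comp_apply] at hsum
  rw [hswap] at hsum
  rw [← hiter]
  have hcongr : ∀ p : EuclideanSpace ℝ (Fin N) × EuclideanSpace ℝ (Fin N),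
      rieszKernelTrunc N i ε (p.1 - p.2) * (φ p.1 - φ p.2) * (f p.1 * f p.2) =
      rieszKernelTrunc N i ε (p.1 - p.2) * (φ p.1 * f p.1 * f p.2) +
        rieszKernelTrunc N i ε (p.swap.1 - p.swap.2) *
          (φ p.swap.1 * f p.swap.1 * f p.swap.2) := by
    intro p
    have hneg := rieszKernelTrunc_neg i ε (p.1 - p.2)
    rw [neg_sub] at hneg
    rw [Prod.fst_swap, Prod.snd_swap, hneg]
    ring
  simp only [hcongr]
  linarith

theorem tendsto_integral_mul_rieszTrunc (hN : 1 ≤ N) (hf : Integrable f) {L : NNReal}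
    (hL : LipschitzWith L f) (hφ : Continuous φ) {C : ℝ} (hC : ∀ x, |φ x| ≤ C) :
    Tendsto (fun ε => ∫ x, φ x * f x * rieszTrunc N i f x ε) (𝓝[>] 0)
      (𝓝 (∫ x, φ x * f x * ((1 / 2) * ∫ z, rieszKernel N i z * (f (x - z) - f (x + z))))) := by
  have hφf : Integrable (fun x => φ x * f x) :=
    hf.bdd_mul hφ.aestronglyMeasurable (ae_of_all _ hC)
  refine tendsto_integral_filter_of_dominated_convergence
    (fun x => |φ x * f x| * (L * (∫ z, localRieszMajorant N z) + ∫ z, |f z|)) ?_ ?_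
    (hφf.abs.mul_const _) (ae_of_all _ fun x => (tendsto_rieszTrunc i hN hf hL x).const_mul _)
  · filter_upwards [self_mem_nhdsWithin] with ε hε
    have h := (integrable_rieszKernelTrunc_mul i hf hφ hC hε).integral_prod_left
    simp only [integral_rieszKernelTrunc_mul] at h
    exact h.aestronglyMeasurable
  · filter_upwards [self_mem_nhdsWithin] with ε hε
    refine ae_of_all _ fun x => ?_
    rw [norm_mul, Real.norm_eq_abs, Real.norm_eq_abs]
    gcongr
    exact abs_rieszTrunc_le i hN hf hL x hε

end RieszKernel

theorem SchwartzMap.exists_lipschitzWith {E F : Type*} [NormedAddCommGroup E] [NormedSpace ℝ E]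
    [NormedAddCommGroup F] [NormedSpace ℝ F] (f : 𝓢(E, F)) :
    ∃ L : NNReal, LipschitzWith L f := by
  refine ⟨(SchwartzMap.seminorm ℝ 0 1 f).toNNReal,
    lipschitzWith_of_nnnorm_fderiv_le f.differentiable fun x => ?_⟩
  rw [← NNReal.coe_le_coe, coe_nnnorm, Real.coe_toNNReal _ (apply_nonneg _ _),
    ← norm_iteratedFDeriv_one]
  exact f.norm_iteratedFDeriv_le_seminorm ℝ 1 x

/-- Let `N ≥ 1`, `f ∈ S(ℝ^N)`, `φ : ℝ^N → ℝ` bounded and Lipschitz, and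
`i ∈ {1,…,N}`.  Then the principal-value limits defining `R_i f (x)` exist for a.e. `x`,
the double integral below converges absolutely, and
`∫ φ(x) f(x) R_i f(x) dx = (c_N/2) ∬ ((x_i − y_i)(φ(x) − φ(y))/|x−y|^{N+1}) f(x) f(y) dx dy`,
where `c_N > 0` is the dimensional normalizing constant of the Riesz transform. -/
theorem statement0 (N : ℕ) (hN : 1 ≤ N) (cN : ℝ) (hcN : 0 < cN)
    (f : SchwartzMap (EuclideanSpace ℝ (Fin N)) ℝ)
    (φ : EuclideanSpace ℝ (Fin N) → ℝ)
    (hφbdd : ∃ C : ℝ, ∀ x, |φ x| ≤ C)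
    (hφlip : ∃ K : NNReal, LipschitzWith K φ)
    (i : Fin N) :
    ∃ R : EuclideanSpace ℝ (Fin N) → ℝ,
      (∀ᵐ x : EuclideanSpace ℝ (Fin N),
        Tendsto (fun ε : ℝ => cN * rieszTrunc N i (⇑f) x ε) (nhdsWithin 0 (Set.Ioi 0))
          (nhds (R x))) ∧
      Integrable (fun p : EuclideanSpace ℝ (Fin N) × EuclideanSpace ℝ (Fin N) =>
        ((p.1 i - p.2 i) * (φ p.1 - φ p.2) / ‖p.1 - p.2‖ ^ (N + 1)) * f p.1 * f p.2)
        (volume.prod volume) ∧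
      ∫ x, φ x * f x * R x =
        (cN / 2) * ∫ p : EuclideanSpace ℝ (Fin N) × EuclideanSpace ℝ (Fin N),
          ((p.1 i - p.2 i) * (φ p.1 - φ p.2) / ‖p.1 - p.2‖ ^ (N + 1)) * f p.1 * f p.2
            ∂(volume.prod volume) := by
  obtain ⟨C, hC⟩ := hφbdd
  obtain ⟨K, hK⟩ := hφlip
  obtain ⟨L, hL⟩ := f.exists_lipschitzWith
  have hf : Integrable f := f.integrable
  have hM : ∀ x, |f x| ≤ SchwartzMap.seminorm ℝ 0 0 f := f.norm_le_seminorm ℝ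
  have hkernel : ∀ p : EuclideanSpace ℝ (Fin N) × EuclideanSpace ℝ (Fin N),
      ((p.1 i - p.2 i) * (φ p.1 - φ p.2) / ‖p.1 - p.2‖ ^ (N + 1)) * f p.1 * f p.2 =
      rieszKernel N i (p.1 - p.2) * (φ p.1 - φ p.2) * (f p.1 * f p.2) := fun p => by
    rw [rieszKernel, PiLp.sub_apply]
    ring
  simp only [hkernel]
  refine ⟨fun x => cN * ((1 / 2) * ∫ z, rieszKernel N i z * (f (x - z) - f (x + z))),
    ae_of_all _ fun x => (tendsto_rieszTrunc i hN hf hL x).const_mul cN,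
    integrable_rieszKernel_commutator i hN hf f.continuous hM hK hC, ?_⟩
  have hlim := (tendsto_integral_rieszKernelTrunc_commutator i hN hf f.continuous hM hK
    hC).const_mul (1 / 2)
  have heq := tendsto_nhds_unique (tendsto_integral_mul_rieszTrunc i hN hf hL hK.continuous hC)
    (hlim.congr' (by
      filter_upwards [self_mem_nhdsWithin] with ε hε
      exact (integral_mul_rieszTrunc i hf hK.continuous hC hε).symm))
  simp only [mul_left_comm _ cN]
  rw [integral_const_mul, heq]
  ring
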